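/- Let a > 0 and α ∈ ℂ, and let U := {(u, φ) ∈ ℝ² : u > 0}. Define first-order differential operators on smooth complex-valued functions f on U by: L₁f = cos φ·∂_u f − (sin φ/a)·coth(u/a)·∂_φ f + i·(sin φ/(a·sinh(u/a)))·α·f; L₂f = sin φ·∂_u f + (cos φ/a)·coth(u/a)·∂_φ f − i·(cos φ/(a·sinh(u/a)))·α·f; L₃f = −(1/a²)·∂_φ f. Then these operators form a representation of the Lie algebra of SO(1,2): for every smooth f on U, [L₁, L₂]f = −L₃f, [L₃, L₁]f = (1/a²)·L₂f, and [L₃, L₂]f = −(1/a²)·L₁f. -/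

import Mathlib

open Matrix BigOperators

/-- The twisted Lie derivative `L₁` on the hyperbolic plane of pseudo-radius `a` in polar
normal coordinates `(u, φ)`, acting on sections of the line bundle of weight `α`. -/
noncomputable def LH1 (a : ℝ) (α : ℂ) (f : ℝ × ℝ → ℂ) : ℝ × ℝ → ℂ := fun x =>
  (Real.cos x.2 : ℂ) * fderiv ℝ f x (1, 0)
    - ((Real.sin x.2 / a * (Real.cosh (x.1 / a) / Real.sinh (x.1 / a)) : ℝ) : ℂ) *
        fderiv ℝ f x (0, 1)
    + Complex.I * ((Real.sin x.2 / (a * Real.sinh (x.1 / a)) : ℝ) : ℂ) * α * f x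

/-- The twisted Lie derivative `L₂` on the hyperbolic plane of pseudo-radius `a`. -/
noncomputable def LH2 (a : ℝ) (α : ℂ) (f : ℝ × ℝ → ℂ) : ℝ × ℝ → ℂ := fun x =>
  (Real.sin x.2 : ℂ) * fderiv ℝ f x (1, 0)
    + ((Real.cos x.2 / a * (Real.cosh (x.1 / a) / Real.sinh (x.1 / a)) : ℝ) : ℂ) *
        fderiv ℝ f x (0, 1)
    - Complex.I * ((Real.cos x.2 / (a * Real.sinh (x.1 / a)) : ℝ) : ℂ) * α * f x

/-- The twisted Lie derivative `L₃` on the hyperbolic plane of pseudo-radius `a`. -/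
noncomputable def LH3 (a : ℝ) (f : ℝ × ℝ → ℂ) : ℝ × ℝ → ℂ := fun x =>
  -((1 / a^2 : ℝ) : ℂ) * fderiv ℝ f x (0, 1)

/-- The first-order operator `A ∂ᵤ + B ∂ᵩ + k C` with real coefficient functions `A`, `B`, `C`
and a complex constant `k`. -/
noncomputable def firstOrderOp (A B C : ℝ × ℝ → ℝ) (k : ℂ) (f : ℝ × ℝ → ℂ) : ℝ × ℝ → ℂ :=
  fun x => (A x : ℂ) * fderiv ℝ f x (1, 0) + (B x : ℂ) * fderiv ℝ f x (0, 1) + k * (C x : ℂ) * f x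

/-- `g` is differentiable at `x` with partial derivatives `p` and `q`. -/
def HasPartialsAt (g : ℝ × ℝ → ℝ) (p q : ℝ) (x : ℝ × ℝ) : Prop :=
  HasFDerivAt g (p • ContinuousLinearMap.fst ℝ ℝ ℝ + q • ContinuousLinearMap.snd ℝ ℝ ℝ) x

theorem HasPartialsAt.mul_of_hasDerivAt {g h : ℝ → ℝ} {g' h' : ℝ} {x : ℝ × ℝ}
    (hg : HasDerivAt g g' x.1) (hh : HasDerivAt h h' x.2) :
    HasPartialsAt (fun y => g y.1 * h y.2) (g' * h x.2) (g x.1 * h') x := by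
  have h₁ : HasFDerivAt (fun y : ℝ × ℝ => g y.1) _ x :=
    hg.comp_hasFDerivAt x (ContinuousLinearMap.fst ℝ ℝ ℝ).hasFDerivAt
  have h₂ : HasFDerivAt (fun y : ℝ × ℝ => h y.2) _ x :=
    hh.comp_hasFDerivAt x (ContinuousLinearMap.snd ℝ ℝ ℝ).hasFDerivAt
  refine (h₁.mul h₂).congr_fderiv ?_
  ext <;> simp [mul_comm]

theorem hasPartialsAt_const (c : ℝ) (x : ℝ × ℝ) : HasPartialsAt (fun _ => c) 0 0 x := by
  simpa [HasPartialsAt] using hasFDerivAt_const c x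

theorem fderiv_firstOrderOp {A B C : ℝ × ℝ → ℝ} {Au Aφ Bu Bφ Cu Cφ : ℝ} {k : ℂ}
    {f : ℝ × ℝ → ℂ} {x : ℝ × ℝ} (hA : HasPartialsAt A Au Aφ x) (hB : HasPartialsAt B Bu Bφ x)
    (hC : HasPartialsAt C Cu Cφ x) (hf : ContDiffAt ℝ 2 f x) (v : ℝ × ℝ) :
    fderiv ℝ (firstOrderOp A B C k f) x v =
      ((Au * v.1 + Aφ * v.2 : ℝ) : ℂ) * fderiv ℝ f x (1, 0)
        + (A x : ℂ) * fderiv ℝ (fderiv ℝ f) x v (1, 0)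
        + (((Bu * v.1 + Bφ * v.2 : ℝ) : ℂ) * fderiv ℝ f x (0, 1)
          + (B x : ℂ) * fderiv ℝ (fderiv ℝ f) x v (0, 1))
        + (k * ((Cu * v.1 + Cφ * v.2 : ℝ) : ℂ) * f x + k * (C x : ℂ) * fderiv ℝ f x v) := by
  have hf₁ : HasFDerivAt f (fderiv ℝ f x) x := (hf.differentiableAt (by norm_num)).hasFDerivAt
  have hf₂ : HasFDerivAt (fderiv ℝ f) (fderiv ℝ (fderiv ℝ f) x) x :=
    ((hf.fderiv_right (m := 1) (by norm_num)).differentiableAt (by norm_num)).hasFDerivAt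
  have hev (w : ℝ × ℝ) := hf₂.clm_apply (hasFDerivAt_const w x)
  have hofReal {g : ℝ × ℝ → ℝ} {p q : ℝ} (hg : HasPartialsAt g p q x) :=
    Complex.ofRealCLM.hasFDerivAt.comp x hg
  have key : HasFDerivAt (firstOrderOp A B C k f) _ x :=
    (((hofReal hA).mul (hev (1, 0))).add ((hofReal hB).mul (hev (0, 1)))).add
      (((hofReal hC).const_mul k).mul hf₁)
  rw [key.fderiv]
  simp
  ring

/-- The second-order terms of the commutator of two first-order operators cancel. -/
theorem firstOrderOp_commutator {A₁ B₁ C₁ A₂ B₂ C₂ : ℝ × ℝ → ℝ}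
    {A₁u A₁φ B₁u B₁φ C₁u C₁φ A₂u A₂φ B₂u B₂φ C₂u C₂φ : ℝ} {k₁ k₂ : ℂ}
    {f : ℝ × ℝ → ℂ} {x : ℝ × ℝ}
    (hA₁ : HasPartialsAt A₁ A₁u A₁φ x) (hB₁ : HasPartialsAt B₁ B₁u B₁φ x)
    (hC₁ : HasPartialsAt C₁ C₁u C₁φ x) (hA₂ : HasPartialsAt A₂ A₂u A₂φ x)
    (hB₂ : HasPartialsAt B₂ B₂u B₂φ x) (hC₂ : HasPartialsAt C₂ C₂u C₂φ x)
    (hf : ContDiffAt ℝ 2 f x) :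
    firstOrderOp A₁ B₁ C₁ k₁ (firstOrderOp A₂ B₂ C₂ k₂ f) x
        - firstOrderOp A₂ B₂ C₂ k₂ (firstOrderOp A₁ B₁ C₁ k₁ f) x =
      ((A₁ x * A₂u + B₁ x * A₂φ - A₂ x * A₁u - B₂ x * A₁φ : ℝ) : ℂ) * fderiv ℝ f x (1, 0)
        + ((A₁ x * B₂u + B₁ x * B₂φ - A₂ x * B₁u - B₂ x * B₁φ : ℝ) : ℂ) * fderiv ℝ f x (0, 1)
        + (k₂ * ((A₁ x * C₂u + B₁ x * C₂φ : ℝ) : ℂ)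
          - k₁ * ((A₂ x * C₁u + B₂ x * C₁φ : ℝ) : ℂ)) * f x := by
  have hsymm : fderiv ℝ (fderiv ℝ f) x (1, 0) (0, 1) = fderiv ℝ (fderiv ℝ f) x (0, 1) (1, 0) :=
    hf.isSymmSndFDerivAt (by simp) (1, 0) (0, 1)
  rw [firstOrderOp, firstOrderOp.eq_def A₂ B₂ C₂ k₂ (firstOrderOp _ _ _ _ _)]
  simp only [fderiv_firstOrderOp hA₁ hB₁ hC₁ hf, fderiv_firstOrderOp hA₂ hB₂ hC₂ hf]
  rw [hsymm]
  simp only [firstOrderOp]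
  push_cast
  ring

theorem LH1_eq_firstOrderOp (a : ℝ) (α : ℂ) :
    LH1 a α = firstOrderOp (fun x => 1 * Real.cos x.2)
      (fun x => Real.cosh (x.1 / a) / Real.sinh (x.1 / a) * (-Real.sin x.2 / a))
      (fun x => (Real.sinh (x.1 / a))⁻¹ * (Real.sin x.2 / a)) (Complex.I * α) := by
  funext f x
  simp only [LH1, firstOrderOp]
  push_cast
  ring

theorem LH2_eq_firstOrderOp (a : ℝ) (α : ℂ) :
    LH2 a α = firstOrderOp (fun x => 1 * Real.sin x.2)
      (fun x => Real.cosh (x.1 / a) / Real.sinh (x.1 / a) * (Real.cos x.2 / a))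
      (fun x => (Real.sinh (x.1 / a))⁻¹ * (Real.cos x.2 / a)) (-Complex.I * α) := by
  funext f x
  simp only [LH2, firstOrderOp]
  push_cast
  ring

theorem LH3_eq_firstOrderOp (a : ℝ) :
    LH3 a = firstOrderOp (fun _ => 0) (fun _ => -(1 / a ^ 2)) (fun _ => 0) 0 := by
  funext f x
  simp [LH3, firstOrderOp]

theorem hasDerivAt_coth_div {a u : ℝ} (hs : Real.sinh (u / a) ≠ 0) :
    HasDerivAt (fun t => Real.cosh (t / a) / Real.sinh (t / a))
      (-1 / (a * Real.sinh (u / a) ^ 2)) u := by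
  have hd : HasDerivAt (fun t : ℝ => t / a) (1 / a) u := (hasDerivAt_id u).div_const a
  refine (hd.cosh.div hd.sinh hs).congr_deriv ?_
  rw [← div_div]
  field_simp
  linear_combination -(Real.cosh_sq (u / a)) / a

theorem hasDerivAt_inv_sinh_div {a u : ℝ} (hs : Real.sinh (u / a) ≠ 0) :
    HasDerivAt (fun t => (Real.sinh (t / a))⁻¹)
      (-Real.cosh (u / a) / (a * Real.sinh (u / a) ^ 2)) u := by
  have hd : HasDerivAt (fun t : ℝ => t / a) (1 / a) u := (hasDerivAt_id u).div_const a
  refine (hd.sinh.inv hs).congr_deriv ?_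
  rw [← div_div]
  ring

/-- The twisted Lie derivatives on `H² = SO(1,2)/SO(2)` form a representation of the Lie
algebra of `SO(1,2)`: `[L₁,L₂] = −L₃`, `[L₃,L₁] = (1/a²)L₂`, `[L₃,L₂] = −(1/a²)L₁`. -/
theorem hyperbolic_lie_algebra_representation
    (a : ℝ) (ha : 0 < a) (α : ℂ)
    (f : ℝ × ℝ → ℂ) (hf : ContDiff ℝ (⊤ : ℕ∞) f) :
    ∀ x : ℝ × ℝ, 0 < x.1 →
      (LH1 a α (LH2 a α f) x - LH2 a α (LH1 a α f) x = -(LH3 a f x)) ∧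
      (LH3 a (LH1 a α f) x - LH1 a α (LH3 a f) x = ((1 / a^2 : ℝ) : ℂ) * LH2 a α f x) ∧
      (LH3 a (LH2 a α f) x - LH2 a α (LH3 a f) x = -((1 / a^2 : ℝ) : ℂ) * LH1 a α f x) := by
  intro x hx
  have hs : Real.sinh (x.1 / a) ≠ 0 := (Real.sinh_pos_iff.2 (div_pos hx ha)).ne'
  have hf₂ : ContDiffAt ℝ 2 f x := (contDiff_infty.1 hf 2).contDiffAt
  have hsin := Real.hasDerivAt_sin x.2
  have hcos := Real.hasDerivAt_cos x.2
  have hcoth := hasDerivAt_coth_div hs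
  have hcsch := hasDerivAt_inv_sinh_div hs
  have hone := hasDerivAt_const x.1 (1 : ℝ)
  have A₁ := HasPartialsAt.mul_of_hasDerivAt hone hcos
  have B₁ := HasPartialsAt.mul_of_hasDerivAt hcoth (hsin.fun_neg.div_const a)
  have C₁ := HasPartialsAt.mul_of_hasDerivAt hcsch (hsin.div_const a)
  have A₂ := HasPartialsAt.mul_of_hasDerivAt hone hsin
  have B₂ := HasPartialsAt.mul_of_hasDerivAt hcoth (hcos.div_const a)
  have C₂ := HasPartialsAt.mul_of_hasDerivAt hcsch (hcos.div_const a)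
  have hz := hasPartialsAt_const 0 x
  have hc := hasPartialsAt_const (-(1 / a ^ 2)) x
  rw [LH1_eq_firstOrderOp, LH2_eq_firstOrderOp, LH3_eq_firstOrderOp,
    firstOrderOp_commutator A₁ B₁ C₁ A₂ B₂ C₂ hf₂,
    firstOrderOp_commutator hz hc hz A₁ B₁ C₁ hf₂,
    firstOrderOp_commutator hz hc hz A₂ B₂ C₂ hf₂]
  simp only [firstOrderOp]
  have ha' : (a : ℂ) ≠ 0 := mod_cast ha.ne'
  have hs' : (Real.sinh (x.1 / a) : ℂ) ≠ 0 := mod_cast hs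
  have hcosh : (Real.cosh (x.1 / a) : ℂ) ^ 2 = (Real.sinh (x.1 / a) : ℂ) ^ 2 + 1 :=
    mod_cast Real.cosh_sq (x.1 / a)
  have htrig : (Real.sin x.2 : ℂ) ^ 2 + (Real.cos x.2 : ℂ) ^ 2 = 1 :=
    mod_cast Real.sin_sq_add_cos_sq x.2
  generalize Real.sinh (x.1 / a) = s at *
  generalize Real.cosh (x.1 / a) = c at *
  generalize Real.sin x.2 = p at *
  generalize Real.cos x.2 = q at *
  refine ⟨?_, ?_, ?_⟩
  · push_cast
    field_simp
    linear_combination fderiv ℝ f x (0, 1) *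
      (((p : ℂ) ^ 2 + (q : ℂ) ^ 2) * hcosh + (s : ℂ) ^ 2 * htrig)
  · push_cast
    field_simp
    ring
  · push_cast
    field_simp
    ring
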